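/- Let n, d be integers with 1 ≤ d < n, α > 0, φ ∈ L¹(0,∞), and suppose K ∈ C₀(ℝⁿ∖{0}) ∩ L∞(ℝⁿ) is (d,α)-distance-orthogonal. Then the kernel K̃(x) = ∫₀^∞ K(tx) φ(t) dt is also (d,α)-distance-orthogonal. Moreover, if φ ∈ C^k(0,∞) with ∫₀^∞ t^m |φ^{(m)}(t)| dt < ∞ for m = 1,…,k, then for each x ≠ 0 the map t ↦ K̃(tx) is C^k on (0,∞), and for each m = 0,1,…,k there is a constant M_m, independent of x, with sup_{t>0} |t^m (d^m/dt^m) K̃(tx)| ≤ M_m. -/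

import Mathlib

open MeasureTheory Metric Set Filter
open scoped Topology ENNReal NNReal

noncomputable section

abbrev ES (n : ℕ) := EuclideanSpace ℝ (Fin n)

/-- The regularized "R" function `R_{K,μ,α}` with dimension parameter `d`. -/
def RK {n : ℕ} (d α : ℝ) (K : ES n → ℝ) (μ : Measure (ES n)) (x : ES n) : ℝ :=
  ∫ y, K (x - y) / ‖x - y‖ ^ (d + α) ∂μ

/-- The regularized distance `D_{K,μ,α} = R_{K,μ,α}^{-1/α}`. -/
def DK {n : ℕ} (d α : ℝ) (K : ES n → ℝ) (μ : Measure (ES n)) (x : ES n) : ℝ :=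
  RK d α K μ x ^ (-α⁻¹)

/-- `d`-dimensional Hausdorff measure restricted to a subspace. -/
def planeMeasure {n : ℕ} (d : ℕ) (E : Submodule ℝ (ES n)) : Measure (ES n) :=
  (μH[(d : ℝ)]).restrict (E : Set (ES n))

/-- `K` is `(d,α)`-distance-exact. -/
def DistExact (n d : ℕ) (α : ℝ) (K : ES n → ℝ) : Prop :=
  ∀ E : Submodule ℝ (ES n), Module.finrank ℝ ↥E = d →
    ∃ c : ℝ, ∀ x ∉ E, DK (d : ℝ) α K (planeMeasure d E) x = c * infDist x (E : Set (ES n))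

/-- `K` is `(d,α)`-distance-orthogonal. -/
def DistOrth (n d : ℕ) (α : ℝ) (K : ES n → ℝ) : Prop :=
  ∀ E : Submodule ℝ (ES n), Module.finrank ℝ ↥E = d →
    ∀ x ∉ E, RK (d : ℝ) α K (planeMeasure d E) x = 0

/-- `K` is a distance-standard kernel. -/
def DistStandard {n : ℕ} (K : ES n → ℝ) : Prop :=
  ContDiffOn ℝ 2 K {0}ᶜ ∧
  (∀ m : ℕ, m ≤ 2 → ∃ C : ℝ, ∀ x : ES n, x ≠ 0 →
      ‖iteratedFDerivWithin ℝ m K {0}ᶜ x‖ * ‖x‖ ^ m ≤ C) ∧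
  ∃ c > 0, ∀ x : ES n, x ≠ 0 → c ≤ K x

/-- The square function `F_{K,μ,α}` relative to the set `E`. -/
def FK {n : ℕ} (d α : ℝ) (K : ES n → ℝ) (μ : Measure (ES n)) (E : Set (ES n)) (x : ES n) : ℝ :=
  infDist x E * ‖gradient (fun y => ‖gradient (DK d α K μ) y‖ ^ 2) x‖

/-- `D_{K,μ,α}` satisfies the usual square function estimate (USFE) outside `E`. -/
def SatisfiesUSFE {n : ℕ} (d α : ℝ) (K : ES n → ℝ) (μ : Measure (ES n)) (E : Set (ES n)) : Prop :=
  ∃ C : ℝ, ∀ Q ∈ E, ∀ r > 0,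
    (∫ x in ball Q r ∩ Eᶜ, (FK d α K μ E x) ^ 2 * infDist x E ^ (d - (n : ℝ))) ≤ C * r ^ d

/-- The support of a measure on a metric space. -/
def msupp {X : Type*} [PseudoMetricSpace X] [MeasurableSpace X] (μ : Measure X) : Set X :=
  {x | ∀ r > 0, 0 < μ (ball x r)}

/-- `μ` is `d`-Ahlfors regular with constant `C`. -/
def IsAhlfors {n : ℕ} (d : ℝ) (μ : Measure (ES n)) (C : ℝ) : Prop :=
  1 ≤ C ∧ ∀ Q ∈ msupp μ, ∀ R > 0,
    ENNReal.ofReal (C⁻¹ * R ^ d) ≤ μ (ball Q R) ∧ μ (ball Q R) ≤ ENNReal.ofReal (C * R ^ d)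

/-- A non-tangential cone of aperture `η` and radius `R` at `Q`. -/
def NTcone {n : ℕ} (E : Set (ES n)) (Q : ES n) (R η : ℝ) : Set (ES n) :=
  {x | x ∉ E ∧ dist x Q < R ∧ η * dist x Q ≤ infDist x E}

/-- `f` has non-tangential limit `L` at `Q` with aperture `η`. -/
def HasNTLimit {n : ℕ} (E : Set (ES n)) (f : ES n → ℝ) (Q : ES n) (η L : ℝ) : Prop :=
  ∀ ε > 0, ∃ R > 0, ∀ x ∈ NTcone E Q R η, |f x - L| < ε

/-- A set `E ⊆ ℝⁿ` is `d`-rectifiable. -/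
def RectSet (n d : ℕ) (E : Set (ES n)) : Prop :=
  ∃ f : ℕ → (EuclideanSpace ℝ (Fin d) → ES n),
    (∀ i, ∃ L : ℝ≥0, LipschitzWith L (f i)) ∧
    μH[(d : ℝ)] (E \ ⋃ i, Set.range (f i)) = 0

/-- A measure `μ` is `d`-rectifiable. -/
def RectMeasure (n d : ℕ) (μ : Measure (ES n)) : Prop :=
  μ ≪ μH[(d : ℝ)] ∧ ∃ S : Set (ES n), MeasurableSet S ∧ RectSet n d S ∧ μ Sᶜ = 0

/-- A set `E ⊆ ℝⁿ` is `d`-uniformly rectifiable (the Lipschitz images condition). -/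
def UnifRect (n d : ℕ) (E : Set (ES n)) : Prop :=
  ∃ (M : ℝ≥0) (θ : ℝ), 0 < θ ∧ ∀ Q ∈ E, ∀ R > 0,
    ∃ f : EuclideanSpace ℝ (Fin d) → ES n, LipschitzOnWith M f (ball 0 R) ∧
      ENNReal.ofReal (θ * R ^ d) ≤ μH[(d : ℝ)] (E ∩ ball Q R ∩ f '' (ball 0 R))

end

/-- The multiplicative convolution `t ↦ ∫₀^∞ k(ut) g(u) du` of functions on `(0, ∞)`. -/
noncomputable def mulConv (k g : ℝ → ℝ) (t : ℝ) : ℝ := ∫ u in Ioi (0 : ℝ), k (u * t) * g u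

section MulConv

variable {k g w : ℝ → ℝ} {C : ℝ}

theorem integrableOn_mulConv (hk : Measurable k) (hC : ∀ u, |k u| ≤ C)
    (hg : IntegrableOn g (Ioi 0)) (t : ℝ) :
    IntegrableOn (fun u => k (u * t) * g u) (Ioi 0) :=
  Integrable.bdd_mul (c := C) hg
    (hk.comp (measurable_id.mul_const t)).aestronglyMeasurable
    (Eventually.of_forall fun u => hC (u * t))

theorem abs_mulConv_le (hC : ∀ u, |k u| ≤ C)
    (hg : IntegrableOn g (Ioi 0)) (t : ℝ) :
    |mulConv k g t| ≤ C * ∫ u in Ioi (0 : ℝ), |g u| := by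
  rw [mulConv, ← integral_const_mul, ← Real.norm_eq_abs]
  refine norm_integral_le_of_norm_le (hg.abs.const_mul C) (Eventually.of_forall fun u => ?_)
  rw [Real.norm_eq_abs, abs_mul]
  exact mul_le_mul_of_nonneg_right (hC _) (abs_nonneg _)

theorem continuousOn_mulConv (hkm : Measurable k) (hk : ContinuousOn k (Ioi 0))
    (hC : ∀ u, |k u| ≤ C) (hg : IntegrableOn g (Ioi 0)) :
    ContinuousOn (mulConv k g) (Ioi 0) := by
  refine continuousOn_of_dominated (bound := fun u => C * |g u|)
    (fun t _ => (integrableOn_mulConv hkm hC hg t).aestronglyMeasurable)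
    (fun t _ => Eventually.of_forall fun u => ?_) (hg.abs.const_mul C) ?_
  · rw [Real.norm_eq_abs, abs_mul]
    exact mul_le_mul_of_nonneg_right (hC _) (abs_nonneg _)
  · filter_upwards [ae_restrict_mem measurableSet_Ioi] with u hu
    refine ContinuousOn.mul (hk.comp (by fun_prop) fun t ht => ?_) continuousOn_const
    exact mul_pos (mem_Ioi.1 hu) (mem_Ioi.1 ht)

theorem integral_Ioi_mul_comp_mul_inv (k g : ℝ → ℝ) {t : ℝ} (ht : 0 < t) :
    ∫ s in Ioi (0 : ℝ), k s * g (s * t⁻¹) = t * mulConv k g t := by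
  have h := integral_comp_mul_right_Ioi' (fun s => k s * g (s * t⁻¹)) 0 ht
  rw [zero_mul] at h
  rw [← h, smul_eq_mul]
  simp only [mulConv, mul_assoc, mul_inv_cancel₀ ht.ne', mul_one]

theorem integrableOn_Ioi_comp_mul_inv (hg : IntegrableOn g (Ioi 0)) {t : ℝ} (ht : 0 < t) :
    IntegrableOn (fun s => g (s * t⁻¹)) (Ioi 0) := by
  rw [integrableOn_Ioi_comp_mul_right_iff g 0 (inv_pos.2 ht), zero_mul]
  exact hg

theorem integrable_dilation_prod (hw : IntegrableOn w (Ioi 0)) (hwc : ContinuousOn w (Ioi 0))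
    {a b : ℝ} (ha : 0 < a) :
    Integrable (fun p : ℝ × ℝ => p.1⁻¹ * w (p.2 * p.1⁻¹))
      ((volume.restrict (Ioc a b)).prod (volume.restrict (Ioi 0))) := by
  have hpos : ∀ τ ∈ Ioc a b, 0 < τ := fun τ hτ => ha.trans hτ.1
  have hm : AEStronglyMeasurable (fun p : ℝ × ℝ => p.1⁻¹ * w (p.2 * p.1⁻¹))
      ((volume.restrict (Ioc a b)).prod (volume.restrict (Ioi 0))) := by
    rw [Measure.prod_restrict]
    refine ContinuousOn.aestronglyMeasurable ?_ (measurableSet_Ioc.prod measurableSet_Ioi)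
    have hinv : ContinuousOn (fun p : ℝ × ℝ => p.1⁻¹) (Ioc a b ×ˢ Ioi 0) :=
      continuousOn_fst.inv₀ fun p hp => (hpos _ hp.1).ne'
    exact hinv.mul (hwc.comp (continuousOn_snd.mul hinv)
      fun p hp => mul_pos (mem_Ioi.1 hp.2) (inv_pos.2 (hpos _ hp.1)))
  rw [integrable_prod_iff hm]
  constructor
  · filter_upwards [ae_restrict_mem measurableSet_Ioc] with τ hτ
    exact (integrableOn_Ioi_comp_mul_inv hw (hpos τ hτ)).const_mul _
  · refine (integrable_const (∫ u in Ioi (0 : ℝ), |w u|)).congr ?_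
    filter_upwards [ae_restrict_mem measurableSet_Ioc] with τ hτ
    have hτ0 := hpos τ hτ
    have h := integral_comp_mul_right_Ioi (fun u => |w u|) 0 (inv_pos.2 hτ0)
    simp only [norm_mul, Real.norm_eq_abs, integral_const_mul]
    rw [h, zero_mul, smul_eq_mul, abs_of_pos (inv_pos.2 hτ0), inv_inv, inv_mul_cancel_left₀ hτ0.ne']

theorem mul_mulConv_eq_sub_integral (hkm : Measurable k) (hC : ∀ u, |k u| ≤ C)
    (hg : IntegrableOn g (Ioi 0)) (hw : IntegrableOn w (Ioi 0)) (hwc : ContinuousOn w (Ioi 0))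
    (hgw : ∀ u, 0 < u → HasDerivAt g (w u / u) u) {t₀ t : ℝ} (ht₀ : 0 < t₀) (ht : t₀ ≤ t) :
    t * mulConv k g t = t₀ * mulConv k g t₀ - ∫ τ in t₀..t, mulConv k w τ := by
  have htpos := ht₀.trans_le ht
  have hki (τ : ℝ) (hτ : 0 < τ) : IntegrableOn (fun s => k s * g (s * τ⁻¹)) (Ioi 0) :=
    (integrableOn_Ioi_comp_mul_inv hg hτ).bdd_mul (c := C)
      hkm.aestronglyMeasurable (Eventually.of_forall fun s => hC s)
  have hInt : Integrable
      (Function.uncurry fun τ s : ℝ => k s * (τ⁻¹ * w (s * τ⁻¹)))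
      ((volume.restrict (Ioc t₀ t)).prod (volume.restrict (Ioi 0))) :=
    (integrable_dilation_prod hw hwc ht₀).bdd_mul (c := C)
      (hkm.comp measurable_snd).aestronglyMeasurable (Eventually.of_forall fun p => hC p.2)
  have hftc (s : ℝ) (hs : 0 < s) :
      ∫ τ in Ioc t₀ t, k s * (τ⁻¹ * w (s * τ⁻¹)) = k s * g (s * t₀⁻¹) - k s * g (s * t⁻¹) := by
    have hsub : ∀ τ ∈ uIcc t₀ t, 0 < τ := fun τ hτ => by
      rw [uIcc_of_le ht] at hτ
      exact ht₀.trans_le hτ.1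
    have hd : ∀ τ ∈ uIcc t₀ t,
        HasDerivAt (fun τ => -(k s * g (s * τ⁻¹))) (k s * (τ⁻¹ * w (s * τ⁻¹))) τ := by
      intro τ hτ
      have hτ0 := hsub τ hτ
      have h := (((hgw (s * τ⁻¹) (mul_pos hs (inv_pos.2 hτ0))).comp τ
        ((hasDerivAt_inv hτ0.ne').const_mul s)).const_mul (k s)).neg
      refine h.congr_deriv ?_
      field_simp
    have hc : ContinuousOn (fun τ => k s * (τ⁻¹ * w (s * τ⁻¹))) (uIcc t₀ t) := by
      have hinv : ContinuousOn (fun τ : ℝ => τ⁻¹) (uIcc t₀ t) :=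
        continuousOn_id.inv₀ fun τ hτ => (hsub τ hτ).ne'
      exact continuousOn_const.mul (hinv.mul (hwc.comp (continuousOn_const.mul hinv)
        fun τ hτ => mul_pos hs (inv_pos.2 (hsub τ hτ))))
    rw [← intervalIntegral.integral_of_le ht,
      intervalIntegral.integral_eq_sub_of_hasDerivAt hd hc.intervalIntegrable]
    ring
  have hswap := integral_integral_swap hInt
  have hl : ∫ τ in Ioc t₀ t, (∫ s in Ioi (0 : ℝ), k s * (τ⁻¹ * w (s * τ⁻¹)))
      = ∫ τ in t₀..t, mulConv k w τ := by
    rw [intervalIntegral.integral_of_le ht]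
    refine setIntegral_congr_fun measurableSet_Ioc fun τ hτ => ?_
    have hτ0 := ht₀.trans hτ.1
    simp only [mul_left_comm (k _), integral_const_mul]
    rw [integral_Ioi_mul_comp_mul_inv k w hτ0, inv_mul_cancel_left₀ hτ0.ne']
  have hr : ∫ s in Ioi (0 : ℝ), (∫ τ in Ioc t₀ t, k s * (τ⁻¹ * w (s * τ⁻¹)))
      = t₀ * mulConv k g t₀ - t * mulConv k g t := by
    rw [setIntegral_congr_fun measurableSet_Ioi hftc,
      integral_sub (hki t₀ ht₀) (hki t htpos), integral_Ioi_mul_comp_mul_inv k g ht₀,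
      integral_Ioi_mul_comp_mul_inv k g htpos]
  rw [← hl, hswap, hr]
  ring

theorem hasDerivAt_mulConv (hkm : Measurable k) (hk : ContinuousOn k (Ioi 0))
    (hC : ∀ u, |k u| ≤ C)
    (hg : IntegrableOn g (Ioi 0)) (hw : IntegrableOn w (Ioi 0)) (hwc : ContinuousOn w (Ioi 0))
    (hgw : ∀ u, 0 < u → HasDerivAt g (w u / u) u) {t : ℝ} (ht : 0 < t) :
    HasDerivAt (mulConv k g) (-(mulConv k g t + mulConv k w t) / t) t := by
  have hc := continuousOn_mulConv hkm hk hC hw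
  have ht2 : 0 < t / 2 := half_pos ht
  have hI : HasDerivAt (fun r => ∫ τ in (t / 2)..r, mulConv k w τ) (mulConv k w t) t := by
    refine intervalIntegral.integral_hasDerivAt_right
      (hc.mono fun τ hτ => ?_).intervalIntegrable
      (hc.stronglyMeasurableAtFilter isOpen_Ioi t ht) (hc.continuousAt (Ioi_mem_nhds ht))
    rw [uIcc_of_le (by linarith)] at hτ
    exact ht2.trans_le hτ.1
  have h := (((hasDerivAt_const t (t / 2 * mulConv k g (t / 2))).sub hI).div
    (hasDerivAt_id t) ht.ne')
  have heq := mul_mulConv_eq_sub_integral hkm hC hg hw hwc hgw ht2 (half_lt_self ht).le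
  have h' := h.congr_of_eventuallyEq (f₁ := mulConv k g) (by
    filter_upwards [Ioi_mem_nhds (half_lt_self ht)] with r hr
    have hr0 : 0 < r := ht2.trans hr
    have := mul_mulConv_eq_sub_integral hkm hC hg hw hwc hgw ht2 (le_of_lt hr)
    simp only [Pi.sub_apply, Pi.div_apply, id]
    rw [← this, mul_div_cancel_left₀ _ hr0.ne'])
  refine h'.congr_deriv ?_
  simp only [Pi.sub_apply, id]
  rw [← heq]
  field_simp
  ring

end MulConv

/-- If the derivative of `B_j` is `-((j + 1) B_j + B_{j+1}) / t` for each `j < k`, then the derivatives of `B₀` of order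
at most `k` are combinations of the `B_j`, with universal coefficients. -/
theorem exists_iteratedDerivWithin_eq_sum {ι : Type*} (B : ι → ℕ → ℝ → ℝ) (k : ℕ)
    (hB : ∀ i, ∀ j < k, ∀ t, 0 < t →
      HasDerivAt (B i j) (-((j + 1) * B i j t + B i (j + 1) t) / t) t)
    (m : ℕ) (hm : m ≤ k) :
    ∃ c : ℕ → ℝ, ∀ i, ∀ t, 0 < t →
      iteratedDerivWithin m (B i 0) (Ioi 0) t
        = (t ^ m)⁻¹ * ∑ j ∈ Finset.range (m + 1), c j * B i j t := by
  induction m with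
  | zero => exact ⟨fun _ => 1, fun i t _ => by simp⟩
  | succ m ih =>
    obtain ⟨c, hc⟩ := ih (by omega)
    set c' : ℕ → ℝ := fun j => if j ≤ m then c j else 0 with hc'
    refine ⟨fun j => -((m + j + 1) * c' j) - (if j = 0 then 0 else c' (j - 1)), fun i t ht => ?_⟩
    have hd : HasDerivAt (fun t => (t ^ m)⁻¹ * ∑ j ∈ Finset.range (m + 1), c j * B i j t)
        (-(m * t ^ (m - 1)) / (t ^ m) ^ 2 * ∑ j ∈ Finset.range (m + 1), c j * B i j t
          + (t ^ m)⁻¹ * ∑ j ∈ Finset.range (m + 1),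
            c j * (-((j + 1) * B i j t + B i (j + 1) t) / t)) t := by
      refine ((hasDerivAt_pow m t).inv (pow_pos ht m).ne').mul
        (HasDerivAt.fun_sum fun j hj => (hB i j ?_ t ht).const_mul (c j))
      have := Finset.mem_range.1 hj
      omega
    rw [iteratedDerivWithin_succ, derivWithin_congr (s := Ioi 0) (fun s hs => hc i s hs) (hc i t ht),
      hd.hasDerivWithinAt.derivWithin (isOpen_Ioi.uniqueDiffWithinAt ht)]
    have hS : ∑ j ∈ Finset.range (m + 1 + 1),
        (-((m + j + 1) * c' j) - (if j = 0 then 0 else c' (j - 1))) * B i j t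
        = ∑ j ∈ Finset.range (m + 1),
          (-((m + j + 1) * c j) * B i j t - c j * B i (j + 1) t) := by
      simp only [sub_mul, Finset.sum_sub_distrib]
      congr 1
      · rw [Finset.sum_range_succ, hc']
        simp only [show ¬ (m + 1 ≤ m) by omega, if_false, mul_zero, neg_zero, zero_mul, add_zero]
        refine Finset.sum_congr rfl fun j hj => ?_
        rw [if_pos (by have := Finset.mem_range.1 hj; omega)]
      · rw [Finset.sum_range_succ']
        simp only [if_true, zero_mul, add_zero, Nat.add_eq_zero_iff, one_ne_zero, and_false,
          if_false, Nat.add_sub_cancel, hc']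
        refine Finset.sum_congr rfl fun j hj => ?_
        rw [if_pos (by have := Finset.mem_range.1 hj; omega)]
    have hpow : (m : ℝ) * t ^ (m - 1) = m * (t ^ m / t) := by
      cases m with
      | zero => simp
      | succ m => rw [Nat.add_sub_cancel, pow_succ, mul_div_cancel_right₀ _ ht.ne']
    rw [hS, hpow, Finset.mul_sum, Finset.mul_sum, Finset.mul_sum, ← Finset.sum_add_distrib]
    refine Finset.sum_congr rfl fun j _ => ?_
    have := (pow_pos ht m).ne'
    field_simp
    ring

theorem contDiffOn_of_recurrence (B : ℕ → ℝ → ℝ) (k : ℕ)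
    (hB : ∀ j < k, ∀ t, 0 < t →
      HasDerivAt (B j) (-((j + 1) * B j t + B (j + 1) t) / t) t)
    (hc : ∀ j ≤ k, ContinuousOn (B j) (Ioi 0)) :
    ContDiffOn ℝ k (B 0) (Ioi 0) := by
  have hinv (m : ℕ) : DifferentiableOn ℝ (fun t : ℝ => (t ^ m)⁻¹) (Ioi 0) := fun t ht =>
    ((differentiableAt_pow (x := t) m).fun_inv (pow_pos (mem_Ioi.1 ht) m).ne').differentiableWithinAt
  have key := exists_iteratedDerivWithin_eq_sum (fun _ : Unit => B) k (fun _ => hB)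
  refine contDiffOn_of_continuousOn_differentiableOn_deriv (n := (k : ℕ∞))
    (fun m hm => ?_) (fun m hm => ?_)
  · have hm' : m ≤ k := by exact_mod_cast hm
    obtain ⟨c, h⟩ := key m hm'
    refine ContinuousOn.congr ?_ (h ())
    refine (hinv m).continuousOn.mul (continuousOn_finsetSum _ fun j hj => ?_)
    exact continuousOn_const.mul (hc j (by have := Finset.mem_range.1 hj; omega))
  · have hm' : m < k := by exact_mod_cast hm
    obtain ⟨c, h⟩ := key m hm'.le
    refine DifferentiableOn.congr ?_ (h ())
    refine (hinv m).mul (DifferentiableOn.fun_sum fun j hj t ht => ?_)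
    exact ((hB j (by have := Finset.mem_range.1 hj; omega) t
      ht).differentiableAt.differentiableWithinAt).const_mul _

theorem hasDerivAt_pow_mul_iteratedDerivWithin {φ : ℝ → ℝ} {k j : ℕ}
    (hφ : ContDiffOn ℝ k φ (Ioi 0)) (hj : j < k) {u : ℝ} (hu : 0 < u) :
    HasDerivAt (fun u => u ^ j * iteratedDerivWithin j φ (Ioi 0) u)
      ((j * (u ^ j * iteratedDerivWithin j φ (Ioi 0) u)
        + u ^ (j + 1) * iteratedDerivWithin (j + 1) φ (Ioi 0) u) / u) u := by
  have hd : HasDerivAt (iteratedDerivWithin j φ (Ioi 0))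
      (iteratedDerivWithin (j + 1) φ (Ioi 0) u) u := by
    rw [iteratedDerivWithin_succ]
    exact ((hφ.differentiableOn_iteratedDerivWithin (by exact_mod_cast hj)
      isOpen_Ioi.uniqueDiffOn) u hu).hasDerivWithinAt.hasDerivAt (Ioi_mem_nhds hu)
  refine ((hasDerivAt_pow j u).mul hd).congr_deriv ?_
  cases j with
  | zero => field_simp; simp
  | succ j =>
    rw [Nat.add_sub_cancel]
    field_simp
    ring

section Smoothing

variable {k φ : ℝ → ℝ} {C : ℝ} {N : ℕ}

/-- The multiplicative convolutions of `k` with the functions `u ↦ u ^ j φ^{(j)}(u)`. -/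
noncomputable def mulConvDeriv (φ k : ℝ → ℝ) (j : ℕ) : ℝ → ℝ :=
  mulConv k fun u => u ^ j * iteratedDerivWithin j φ (Ioi 0) u

theorem mulConvDeriv_zero (φ k : ℝ → ℝ) : mulConvDeriv φ k 0 = mulConv k φ := by
  simp [mulConvDeriv]

theorem continuousOn_pow_mul_iteratedDerivWithin (hφ : ContDiffOn ℝ N φ (Ioi 0)) {j : ℕ}
    (hj : j ≤ N) :
    ContinuousOn (fun u => u ^ j * iteratedDerivWithin j φ (Ioi 0) u) (Ioi 0) :=
  (continuous_pow j).continuousOn.mul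
    (hφ.continuousOn_iteratedDerivWithin (by exact_mod_cast hj) isOpen_Ioi.uniqueDiffOn)

theorem hasDerivAt_mulConvDeriv (hkm : Measurable k) (hk : ContinuousOn k (Ioi 0))
    (hC : ∀ u, |k u| ≤ C) (hφ : ContDiffOn ℝ N φ (Ioi 0))
    (hInt : ∀ j ≤ N, IntegrableOn (fun u => u ^ j * iteratedDerivWithin j φ (Ioi 0) u) (Ioi 0))
    {j : ℕ} (hj : j < N) {t : ℝ} (ht : 0 < t) :
    HasDerivAt (mulConvDeriv φ k j)
      (-((j + 1) * mulConvDeriv φ k j t + mulConvDeriv φ k (j + 1) t) / t) t := by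
  have hw := ((hInt j hj.le).const_mul (j : ℝ)).add (hInt (j + 1) hj)
  have h := hasDerivAt_mulConv hkm hk hC (hInt j hj.le) hw
    ((continuousOn_const.mul (continuousOn_pow_mul_iteratedDerivWithin hφ hj.le)).add
      (continuousOn_pow_mul_iteratedDerivWithin hφ hj))
    (fun u hu => hasDerivAt_pow_mul_iteratedDerivWithin hφ hj hu) ht
  refine h.congr_deriv ?_
  have hsum : mulConv k (fun u => j * (u ^ j * iteratedDerivWithin j φ (Ioi 0) u)
      + u ^ (j + 1) * iteratedDerivWithin (j + 1) φ (Ioi 0) u) t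
      = j * mulConvDeriv φ k j t + mulConvDeriv φ k (j + 1) t := by
    simp only [mulConvDeriv, mulConv]
    rw [← integral_const_mul, ← integral_add
      ((integrableOn_mulConv hkm hC (hInt j hj.le) t).const_mul _)
      (integrableOn_mulConv hkm hC (hInt (j + 1) hj) t)]
    exact integral_congr_ae (Eventually.of_forall fun u => by ring)
  change -(mulConvDeriv φ k j t + mulConv k (fun u => j * (u ^ j * iteratedDerivWithin j φ (Ioi 0) u)
      + u ^ (j + 1) * iteratedDerivWithin (j + 1) φ (Ioi 0) u) t) / t = _
  rw [hsum]
  ring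

theorem contDiffOn_mulConv (hkm : Measurable k) (hk : ContinuousOn k (Ioi 0))
    (hC : ∀ u, |k u| ≤ C) (hφ : ContDiffOn ℝ N φ (Ioi 0))
    (hInt : ∀ j ≤ N, IntegrableOn (fun u => u ^ j * iteratedDerivWithin j φ (Ioi 0) u) (Ioi 0)) :
    ContDiffOn ℝ N (mulConv k φ) (Ioi 0) := by
  rw [← mulConvDeriv_zero]
  exact contDiffOn_of_recurrence (mulConvDeriv φ k) N
    (fun j hj t ht => hasDerivAt_mulConvDeriv hkm hk hC hφ hInt hj ht)
    (fun j hj => continuousOn_mulConv hkm hk hC (hInt j hj))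

theorem exists_abs_pow_mul_iteratedDerivWithin_mulConv_le {ι : Type*} {k : ι → ℝ → ℝ}
    (hkm : ∀ i, Measurable (k i)) (hk : ∀ i, ContinuousOn (k i) (Ioi 0))
    (hC : ∀ i u, |k i u| ≤ C) (hφ : ContDiffOn ℝ N φ (Ioi 0))
    (hInt : ∀ j ≤ N, IntegrableOn (fun u => u ^ j * iteratedDerivWithin j φ (Ioi 0) u) (Ioi 0))
    {m : ℕ} (hm : m ≤ N) :
    ∃ M : ℝ, ∀ i, ∀ t, 0 < t →
      |t ^ m * iteratedDerivWithin m (mulConv (k i) φ) (Ioi 0) t| ≤ M := by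
  obtain ⟨c, hc⟩ := exists_iteratedDerivWithin_eq_sum (fun i => mulConvDeriv φ (k i)) N
    (fun i j hj t ht => hasDerivAt_mulConvDeriv (hkm i) (hk i) (hC i) hφ hInt hj ht) m hm
  refine ⟨∑ j ∈ Finset.range (m + 1), |c j| *
    (C * ∫ u in Ioi (0 : ℝ), |u ^ j * iteratedDerivWithin j φ (Ioi 0) u|), fun i t ht => ?_⟩
  rw [← mulConvDeriv_zero, hc i t ht, mul_inv_cancel_left₀ (pow_pos ht m).ne']
  refine (Finset.abs_sum_le_sum_abs _ _).trans (Finset.sum_le_sum fun j hj => ?_)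
  rw [abs_mul]
  exact mul_le_mul_of_nonneg_left
    (abs_mulConv_le (hC i) (hInt j (by have := Finset.mem_range.1 hj; omega)) t) (abs_nonneg _)

end Smoothing

section Orthogonality

variable {n d : ℕ} {α : ℝ}

theorem RK_planeMeasure_eq (K : ES n → ℝ) (E : Submodule ℝ (ES n))
    (hE : Module.finrank ℝ E = d) (x : ES n) :
    RK d α K (planeMeasure d E) x
      = ∫ y : E, K (x - y) / ‖x - y‖ ^ ((d : ℝ) + α) ∂μH[(Module.finrank ℝ E : ℝ)] := by
  have h := E.subtypeₗᵢ.isometry.map_hausdorffMeasure (d := (d : ℝ))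
    (Or.inl (Nat.cast_nonneg d))
  have hr : range ((↑) : E → ES n) = E := Subtype.range_coe
  have hme : MeasurableEmbedding ((↑) : E → ES n) :=
    MeasurableEmbedding.subtype_coe E.closed_of_finiteDimensional.measurableSet
  rw [Submodule.coe_subtypeₗᵢ, Submodule.coe_subtype, hr] at h
  rw [RK, planeMeasure, ← h, hme.integral_map, hE]

theorem integrable_norm_sub_rpow_neg (hα : 0 < α) (E : Submodule ℝ (ES n))
    (hE : Module.finrank ℝ E = d) {x : ES n} (hx : x ∉ E) :
    Integrable (fun y : E => (‖x - y‖ ^ ((d : ℝ) + α))⁻¹) μH[(Module.finrank ℝ E : ℝ)] := by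
  have hcl : IsClosed (E : Set (ES n)) := E.closed_of_finiteDimensional
  set δ := infDist x (E : Set (ES n))
  have hδ : 0 < δ := (hcl.notMem_iff_infDist_pos ⟨0, E.zero_mem⟩).1 hx
  have hδle (y : E) : δ ≤ ‖x - y‖ := by
    rw [← dist_eq_norm]
    exact infDist_le_dist_of_mem y.2
  set A := (1 + ‖x‖) / δ + 1
  have hA : 0 < A := by positivity
  have hbd (y : E) : 1 + ‖y‖ ≤ A * ‖x - y‖ := by
    have h1 : ‖(y : ES n)‖ ≤ ‖x‖ + ‖x - y‖ := by
      have := norm_sub_le x (x - (y : ES n))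
      rwa [sub_sub_cancel] at this
    have h2 : 1 + ‖x‖ ≤ (1 + ‖x‖) / δ * ‖x - y‖ := by
      rw [div_mul_eq_mul_div, le_div_iff₀ hδ]
      exact mul_le_mul_of_nonneg_left (hδle y) (by positivity)
    rw [Submodule.coe_norm] at *
    simp only [A, add_mul, one_mul]
    linarith
  have hr : (0 : ℝ) ≤ d + α := by positivity
  refine ((integrable_one_add_norm (E := E) (μ := μH[(Module.finrank ℝ E : ℝ)])
    (r := (d : ℝ) + α) (by rw [hE]; linarith)).const_mul (A ^ ((d : ℝ) + α))).mono' ?_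
    (Eventually.of_forall fun y => ?_)
  · exact Measurable.aestronglyMeasurable (by fun_prop)
  · have hpos : 0 < ‖x - y‖ := hδ.trans_le (hδle y)
    rw [Real.norm_of_nonneg (by positivity), Real.rpow_neg (by positivity),
      ← div_eq_mul_inv, le_div_iff₀ (by positivity), inv_mul_le_iff₀ (by positivity),
      ← Real.mul_rpow hpos.le hA.le, mul_comm _ A]
    exact Real.rpow_le_rpow (by positivity) (hbd y) hr

theorem integral_comp_smul_eq_zero_of_distOrth {K : ES n → ℝ} (hK : DistOrth n d α K)
    (E : Submodule ℝ (ES n)) (hE : Module.finrank ℝ E = d) {x : ES n} (hx : x ∉ E) {t : ℝ}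
    (ht : 0 < t) :
    ∫ y : E, K (t • (x - y)) / ‖x - y‖ ^ ((d : ℝ) + α) ∂μH[(Module.finrank ℝ E : ℝ)] = 0 := by
  have htx : t • x ∉ E := fun h => hx ((E.smul_mem_iff ht.ne').1 h)
  have h := hK E hE _ htx
  rw [RK_planeMeasure_eq K E hE] at h
  have hs := Measure.integral_comp_smul μH[(Module.finrank ℝ E : ℝ)]
    (fun y : E => K (t • x - y) / ‖t • x - y‖ ^ ((d : ℝ) + α)) t
  rw [h, smul_zero] at hs
  have heq (y : E) : K (t • (x - y)) / ‖x - y‖ ^ ((d : ℝ) + α) = t ^ ((d : ℝ) + α) *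
      (K (t • x - (t • y : E)) / ‖t • x - (t • y : E)‖ ^ ((d : ℝ) + α)) := by
    rw [Submodule.coe_smul, ← smul_sub, norm_smul, Real.norm_of_nonneg ht.le,
      Real.mul_rpow ht.le (norm_nonneg _)]
    have := (Real.rpow_pos_of_pos ht ((d : ℝ) + α)).ne'
    field_simp
  simp only [heq, integral_const_mul, hs, mul_zero]

theorem distOrth_integral_smul (hα : 0 < α) {K : ES n → ℝ} (hKm : Measurable K) {C : ℝ}
    (hC : ∀ x, |K x| ≤ C) (hK : DistOrth n d α K) {φ : ℝ → ℝ} (hφ : IntegrableOn φ (Ioi 0)) :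
    DistOrth n d α (fun x => ∫ t in Ioi (0 : ℝ), K (t • x) * φ t) := by
  intro E hE x hx
  rw [RK_planeMeasure_eq _ E hE]
  have hInt : Integrable (Function.uncurry fun (y : E) (t : ℝ) =>
      K (t • (x - y)) * ((‖x - y‖ ^ ((d : ℝ) + α))⁻¹ * φ t))
      (μH[(Module.finrank ℝ E : ℝ)].prod (volume.restrict (Ioi 0))) :=
    ((integrable_norm_sub_rpow_neg hα E hE hx).mul_prod hφ).bdd_mul (c := C)
      (hKm.comp (by fun_prop)).aestronglyMeasurable (Eventually.of_forall fun p => hC _)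
  calc
    _ = ∫ y : E, (∫ t in Ioi (0 : ℝ), K (t • (x - y)) * ((‖x - y‖ ^ ((d : ℝ) + α))⁻¹ * φ t))
          ∂μH[(Module.finrank ℝ E : ℝ)] := by
      refine integral_congr_ae (Eventually.of_forall fun y => ?_)
      simp only [div_eq_mul_inv, ← integral_mul_const]
      exact integral_congr_ae (Eventually.of_forall fun t => by ring)
    _ = ∫ t in Ioi (0 : ℝ), (∫ y : E, K (t • (x - y)) * ((‖x - y‖ ^ ((d : ℝ) + α))⁻¹ * φ t)
          ∂μH[(Module.finrank ℝ E : ℝ)]) := integral_integral_swap hInt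
    _ = ∫ t in Ioi (0 : ℝ), (0 : ℝ) := by
      refine setIntegral_congr_fun measurableSet_Ioi fun t ht => ?_
      simp only [← mul_assoc, ← div_eq_mul_inv, integral_mul_const,
        integral_comp_smul_eq_zero_of_distOrth hK E hE hx ht, zero_mul]
    _ = 0 := by simp

end Orthogonality


/-- radial smoothing preserves `(d,α)`-distance-orthogonality, and if the mollifier
`φ` is `C^k` with Dini-type bounds on its derivatives, the smoothed kernel is `C^k` along rays
with uniformly bounded scale-invariant derivatives. -/
theorem radial_smoothing_of_distance_orthogonal
    (n d : ℕ) (hd : 1 ≤ d) (hdn : d < n) (α : ℝ) (hα : 0 < α)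
    (K : ES n → ℝ) (hKcont : ContinuousOn K {(0 : ES n)}ᶜ)
    (hK0 : Tendsto K (𝓝[≠] (0 : ES n)) (𝓝 0))
    (hKinf : Tendsto K (cocompact (ES n)) (𝓝 0))
    (hKbd : ∃ C : ℝ, ∀ x : ES n, |K x| ≤ C)
    (horth : DistOrth n d α K)
    (φ : ℝ → ℝ) (hφ : IntegrableOn φ (Ioi 0)) :
    DistOrth n d α (fun x => ∫ t in Ioi (0 : ℝ), K (t • x) * φ t) ∧
    (∀ k : ℕ, ContDiffOn ℝ k φ (Ioi 0) →
      (∀ m : ℕ, 1 ≤ m → m ≤ k →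
        IntegrableOn (fun t : ℝ => t ^ m * |iteratedDerivWithin m φ (Ioi 0) t|) (Ioi 0)) →
      (∀ x : ES n, x ≠ 0 →
        ContDiffOn ℝ k
          (fun t : ℝ => ∫ s in Ioi (0 : ℝ), K (s • (t • x)) * φ s) (Ioi 0)) ∧
      (∀ m : ℕ, m ≤ k → ∃ M : ℝ, ∀ x : ES n, x ≠ 0 → ∀ t ∈ Ioi (0 : ℝ),
        |t ^ m *
            iteratedDerivWithin m
              (fun s : ℝ => ∫ u in Ioi (0 : ℝ), K (u • (s • x)) * φ u) (Ioi 0) t|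
          ≤ M)) := by
  obtain ⟨C, hC⟩ := hKbd
  have hKm : Measurable K := measurable_of_continuousOn_compl_singleton 0 hKcont
  refine ⟨distOrth_integral_smul hα hKm hC horth hφ, fun k hφk hφint => ?_⟩
  have hInt : ∀ j ≤ k,
      IntegrableOn (fun u => u ^ j * iteratedDerivWithin j φ (Ioi 0) u) (Ioi 0) := by
    intro j hj
    rcases Nat.eq_zero_or_pos j with rfl | hj0
    · simpa using hφ
    · refine (hφint j hj0 hj).mono'
        ((continuousOn_pow_mul_iteratedDerivWithin hφk hj).aestronglyMeasurable
          measurableSet_Ioi) ?_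
      filter_upwards [ae_restrict_mem measurableSet_Ioi] with u hu
      rw [Real.norm_eq_abs, abs_mul, abs_of_pos (pow_pos (mem_Ioi.1 hu) j)]
  have hray (x : ES n) : (fun t : ℝ => ∫ s in Ioi (0 : ℝ), K (s • (t • x)) * φ s)
      = mulConv (fun u => K (u • x)) φ := by
    ext t
    simp only [mulConv, smul_smul]
  have hm (x : ES n) : Measurable fun u : ℝ => K (u • x) := hKm.comp (by fun_prop)
  have hc {x : ES n} (hx : x ≠ 0) : ContinuousOn (fun u : ℝ => K (u • x)) (Ioi 0) :=
    hKcont.comp (by fun_prop) fun u hu => smul_ne_zero (mem_Ioi.1 hu).ne' hx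
  refine ⟨fun x hx => ?_, fun m hmk => ?_⟩
  · rw [hray]
    exact contDiffOn_mulConv (hm x) (hc hx) (fun u => hC _) hφk hInt
  · obtain ⟨M, hM⟩ := exists_abs_pow_mul_iteratedDerivWithin_mulConv_le
      (k := fun (x : {x : ES n // x ≠ 0}) u => K (u • (x : ES n)))
      (fun x => hm x) (fun x => hc x.2) (fun x u => hC _) hφk hInt hmk
    refine ⟨M, fun x hx t ht => ?_⟩
    rw [hray]
    exact hM ⟨x, hx⟩ t ht
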